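/- Assume V is simple as a K[G]-module. Let Λ be a maximal invariant lattice, set M = Λ/πΛ and W = soc(M) (a simple F[G]-module). Let m ≥ 1 and let W' be a simple F[G]-module isomorphic to a simple F[G]-submodule of soc^m(M)/soc^{m-1}(M). Then there exist simple F[G]-modules U₁, ..., U_m with U₁ ≅ W and U_m ≅ W' such that for each 1 ≤ k < m, the representation realizes a non-split extension of U_{k+1} by U_k. -/

import Mathlib

noncomputable section

attribute [local instance] Classical.propDecidable

open Pointwise

/-! ### Generic machinery: modules equipped with a family of endomorphisms
indexed by a group `G` (i.e. "`R[G]`-modules"). -/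

section Generic

variable {R : Type*} [CommRing R] {M : Type*} [AddCommGroup M] [Module R M]
variable {G : Type*}

/-- A submodule stable under all the endomorphisms `σ g`. -/
def ActStable (σ : G → M →ₗ[R] M) (W : Submodule R M) : Prop :=
  ∀ g : G, ∀ x ∈ W, σ g x ∈ W

/-- The subquotient `W₂ / W₁`. -/
abbrev SubQuot (W₁ W₂ : Submodule R M) : Type _ :=
  W₂ ⧸ (W₁.comap W₂.subtype)

/-- The endomorphism of `W₂/W₁` induced by `σ g` (junk value `0` if `σ g` does not
preserve `W₁` and `W₂`). -/
noncomputable def subQuotMap (σ : G → M →ₗ[R] M) (W₁ W₂ : Submodule R M) (g : G) :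
    SubQuot W₁ W₂ →ₗ[R] SubQuot W₁ W₂ :=
  if h : (∀ x ∈ W₂, σ g x ∈ W₂) ∧ ∀ x ∈ W₂, x ∈ W₁ → σ g x ∈ W₁ then
    Submodule.mapQ _ _ ((σ g).restrict (p := W₂) (q := W₂) h.1)
      (by intro x hx; exact h.2 x x.2 hx)
  else 0

/-- The endomorphism of a stable submodule `W` induced by `σ g`. -/
noncomputable def subAct (σ : G → M →ₗ[R] M) (W : Submodule R M) (g : G) : W →ₗ[R] W :=
  if h : ∀ x ∈ W, σ g x ∈ W then (σ g).restrict h else 0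

/-- The endomorphism of `M ⧸ W` induced by `σ g`. -/
noncomputable def quotMap (σ : G → M →ₗ[R] M) (W : Submodule R M) (g : G) :
    (M ⧸ W) →ₗ[R] (M ⧸ W) :=
  if h : W ≤ W.comap (σ g) then Submodule.mapQ W W (σ g) h else 0

/-- Two modules-with-`G`-action are isomorphic: there is a linear equivalence
commuting with the two actions. -/
def IsRepIso {N : Type*} [AddCommGroup N] [Module R N]
    (σ : G → M →ₗ[R] M) (τ : G → N →ₗ[R] N) : Prop :=
  ∃ e : M ≃ₗ[R] N, ∀ (g : G) (x : M), e (σ g x) = τ g (e x)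

/-- `M` with the action `σ` is a simple module-with-action. -/
def IsSimpleAct (σ : G → M →ₗ[R] M) : Prop :=
  Nontrivial M ∧ ∀ W : Submodule R M, ActStable σ W → W = ⊥ ∨ W = ⊤

/-- `W` is a simple stable submodule of `M`. -/
def IsSimpleSubmodule (σ : G → M →ₗ[R] M) (W : Submodule R M) : Prop :=
  ActStable σ W ∧ W ≠ ⊥ ∧ ∀ U : Submodule R M, ActStable σ U → U ≤ W → U = ⊥ ∨ U = W

/-- The socle: the sum of all simple stable submodules. -/
def actSocle (σ : G → M →ₗ[R] M) : Submodule R M :=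
  sSup {W | IsSimpleSubmodule σ W}

/-- The socle filtration: `socFilt σ 0 = ⊥` and `socFilt σ (k+1)` is the preimage in `M`
of the socle of `M / socFilt σ k`. -/
noncomputable def socFilt (σ : G → M →ₗ[R] M) : ℕ → Submodule R M
  | 0 => ⊥
  | k + 1 => (actSocle (quotMap σ (socFilt σ k))).comap (socFilt σ k).mkQ

/-- `(A₁, A₂)` is a sharp subquotient: every stable submodule strictly containing `A₁`
contains `A₂`. -/
def IsSharp (σ : G → M →ₗ[R] M) (A₁ A₂ : Submodule R M) : Prop :=
  ActStable σ A₁ ∧ ActStable σ A₂ ∧ A₁ < A₂ ∧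
    ∀ W : Submodule R M, ActStable σ W → A₁ < W → A₂ ≤ W

/-- `(A₁, A₂)` is an irreducible subquotient: `A₂/A₁` is simple, i.e. there is no stable
submodule strictly between `A₁` and `A₂`. -/
def IsIrredSubquot (σ : G → M →ₗ[R] M) (A₁ A₂ : Submodule R M) : Prop :=
  ActStable σ A₁ ∧ ActStable σ A₂ ∧ A₁ < A₂ ∧
    ∀ W : Submodule R M, ActStable σ W → A₁ ≤ W → W ≤ A₂ → W = A₁ ∨ W = A₂

end Generic

/-! ### Lattices in representations over a discretely valued field -/

section LatticeDefs

variable {O : Type*} [CommRing O]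
variable {V : Type*} [AddCommGroup V] [Module O V]

/-- A lattice: a finitely generated `O`-submodule of `V` spanning `V` over `K`. -/
def IsLattice (K : Type*) [Field K] [Module K V] (Λ : Submodule O V) : Prop :=
  Λ.FG ∧ Submodule.span K (Λ : Set V) = ⊤

/-- Two lattices are homothetic: `Λ' = λ • Λ` for some nonzero `λ ∈ K`. -/
def Homothetic (K : Type*) [Field K] [SMul K V] (Λ Λ' : Submodule O V) : Prop :=
  ∃ lam : K, lam ≠ 0 ∧ (Λ' : Set V) = lam • (Λ : Set V)

end LatticeDefs

section Lattices

variable {O : Type*} [CommRing O] [IsDomain O] [IsDiscreteValuationRing O]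
variable {K : Type*} [Field K] [Algebra O K] [IsFractionRing O K]
variable {G : Type*} [Group G]
variable {V : Type*} [AddCommGroup V] [Module K V] [Module O V] [IsScalarTower O K V]

/-- The submodule `πΛ`. -/
def piSmul (π : O) (Λ : Submodule O V) : Submodule O V :=
  Λ.map (LinearMap.lsmul O V π)

/-- The `O`-linear `G`-action on `V`. -/
def resAct (ρ : Representation K G V) : G → V →ₗ[O] V :=
  fun g => (ρ g).restrictScalars O

/-- `Λ` is invariant: `gΛ = Λ` for all `g ∈ G`. -/
def IsInvariantSub (ρ : Representation K G V) (Λ : Submodule O V) : Prop :=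
  ∀ g : G, Λ.map (resAct ρ g) = Λ

/-- `Λ` is normalised at `v`: `v ∈ Λ` and `v ∉ πΛ`. -/
def IsNormalizedAt (π : O) (Λ : Submodule O V) (v : V) : Prop :=
  v ∈ Λ ∧ v ∉ piSmul π Λ

/-- `Λ` is an invariant lattice, normalised at `v`, maximal under inclusion among
invariant lattices normalised at `v`. -/
def IsMaximalAt (ρ : Representation K G V) (π : O) (Λ : Submodule O V) (v : V) : Prop :=
  IsLattice K Λ ∧ IsInvariantSub ρ Λ ∧ IsNormalizedAt π Λ v ∧
    ∀ Λ' : Submodule O V, IsLattice K Λ' → IsInvariantSub ρ Λ' → IsNormalizedAt π Λ' v →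
      Λ ≤ Λ' → Λ' = Λ

/-- `Λ` is a maximal invariant lattice: maximal with respect to some nonzero `v`. -/
def IsMaximalLattice (ρ : Representation K G V) (π : O) (Λ : Submodule O V) : Prop :=
  ∃ v : V, v ≠ 0 ∧ IsMaximalAt ρ π Λ v

/-- `V` is simple as a `K[G]`-module. -/
def IsIrreducibleRep (ρ : Representation K G V) : Prop :=
  Nontrivial V ∧ ∀ W : Submodule K V, (∀ g : G, ∀ x ∈ W, ρ g x ∈ W) → W = ⊥ ∨ W = ⊤

/-- The induced `G`-action on the reduction `Λ/πΛ`. -/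
noncomputable def redAct (ρ : Representation K G V) (π : O) (Λ : Submodule O V) :
    G → SubQuot (piSmul π Λ) Λ →ₗ[O] SubQuot (piSmul π Λ) Λ :=
  subQuotMap (resAct ρ) (piSmul π Λ) Λ

/-- The map `Λ/πΛ → Λ'/πΛ'` induced by an inclusion `Λ ≤ Λ'` (junk value `0` if
`Λ ≰ Λ'`). -/
noncomputable def redMap (π : O) (Λ Λ' : Submodule O V) :
    SubQuot (piSmul π Λ) Λ →ₗ[O] SubQuot (piSmul π Λ') Λ' :=
  if h : Λ ≤ Λ' then
    Submodule.mapQ _ _ (Submodule.inclusion h)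
      (by
        intro x hx
        have hx' : (x : V) ∈ piSmul π Λ := hx
        have : (x : V) ∈ piSmul π Λ' := Submodule.map_mono h hx'
        simpa [Submodule.mem_comap] using this)
  else 0

/-- `ρ` realises a non-split extension of `A` (a module with action `τA`) by `B`
(a module with action `τB`): there are an invariant lattice `L` and submodules
`U₀ ⊆ T ⊆ U₁` of `L/πL` with `T/U₀ ≅ B`, `U₁/T ≅ A`, and `T/U₀` has no stable
complement in `U₁/U₀` (i.e. the extension `0 → B → U₁/U₀ → A → 0` does not split). -/
def RealizesExt (ρ : Representation K G V) (π : O)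
    {NA : Type*} [AddCommGroup NA] [Module O NA] {NB : Type*} [AddCommGroup NB] [Module O NB]
    (τA : G → NA →ₗ[O] NA) (τB : G → NB →ₗ[O] NB) : Prop :=
  ∃ L : Submodule O V, IsLattice K L ∧ IsInvariantSub ρ L ∧
    ∃ U₀ U₁ T : Submodule O (SubQuot (piSmul π L) L),
      ActStable (redAct ρ π L) U₀ ∧ ActStable (redAct ρ π L) U₁ ∧
      ActStable (redAct ρ π L) T ∧ U₀ ≤ T ∧ T ≤ U₁ ∧
      IsRepIso (subQuotMap (redAct ρ π L) U₀ T) τB ∧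
      IsRepIso (subQuotMap (redAct ρ π L) T U₁) τA ∧
      ¬ ∃ C : Submodule O (SubQuot (piSmul π L) L), ActStable (redAct ρ π L) C ∧
          U₀ ≤ C ∧ C ≤ U₁ ∧ C ⊓ T = U₀ ∧ C ⊔ T = U₁

end Lattices

/-- The underlying family of linear endomorphisms of a representation. -/
def ofRep {R : Type*} [CommSemiring R] {G : Type*} [Monoid G] {M : Type*} [AddCommMonoid M]
    [Module R M] (σ : Representation R G M) : G → M →ₗ[R] M := fun g => σ g

section ActionModules

variable {R : Type*} [CommRing R] {M : Type*} [AddCommGroup M] [Module R M]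
variable {G : Type*} {σ : G → M →ₗ[R] M}

lemma ActStable.sSup {s : Set (Submodule R M)} (hs : ∀ W ∈ s, ActStable σ W) :
    ActStable σ (SupSet.sSup s) := by
  intro g
  change SupSet.sSup s ≤ (SupSet.sSup s).comap (σ g)
  exact sSup_le fun W hW x hx => (le_sSup hW : W ≤ _) (hs W hW g x hx)

lemma ActStable.sup {P Q : Submodule R M} (hP : ActStable σ P) (hQ : ActStable σ Q) :
    ActStable σ (P ⊔ Q) := by
  intro g x hx
  obtain ⟨p, hp, q, hq, rfl⟩ := Submodule.mem_sup.1 hx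
  rw [map_add]
  exact Submodule.add_mem_sup (hP g p hp) (hQ g q hq)

lemma ActStable.inf {P Q : Submodule R M} (hP : ActStable σ P) (hQ : ActStable σ Q) :
    ActStable σ (P ⊓ Q) :=
  fun g x hx => ⟨hP g x hx.1, hQ g x hx.2⟩

lemma actStable_bot : ActStable σ (⊥ : Submodule R M) := by
  intro g x hx
  rw [Submodule.mem_bot] at hx ⊢
  rw [hx, map_zero]

lemma quotMap_mkQ {S : Submodule R M} (hS : ActStable σ S) (g : G) (x : M) :
    quotMap σ S g (S.mkQ x) = S.mkQ (σ g x) := by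
  have h : S ≤ S.comap (σ g) := fun y hy => hS g y hy
  simp [quotMap, h]

lemma subQuotMap_mkQ {S T : Submodule R M} (hS : ActStable σ S) (hT : ActStable σ T)
    (g : G) (x : T) :
    subQuotMap σ S T g ((S.comap T.subtype).mkQ x) =
      (S.comap T.subtype).mkQ ⟨σ g x, hT g x x.2⟩ := by
  have h : (∀ x ∈ T, σ g x ∈ T) ∧ ∀ x ∈ T, x ∈ S → σ g x ∈ S :=
    ⟨hT g, fun y _ hy => hS g y hy⟩
  rw [subQuotMap, dif_pos h]
  rfl

lemma subAct_coe {W : Submodule R M} (hW : ActStable σ W) (g : G) (x : W) :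
    (subAct σ W g x : M) = σ g x := by
  have h : ∀ x ∈ W, σ g x ∈ W := hW g
  rw [subAct, dif_pos h]
  rfl

lemma IsRepIso.refl (σ : G → M →ₗ[R] M) : IsRepIso σ σ :=
  ⟨LinearEquiv.refl R M, fun _ _ => rfl⟩

lemma IsRepIso.symm {N : Type*} [AddCommGroup N] [Module R N] {τ : G → N →ₗ[R] N}
    (h : IsRepIso σ τ) : IsRepIso τ σ := by
  obtain ⟨e, he⟩ := h
  refine ⟨e.symm, fun g x => ?_⟩
  rw [LinearEquiv.symm_apply_eq, he, LinearEquiv.apply_symm_apply]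

lemma IsRepIso.trans {N : Type*} [AddCommGroup N] [Module R N] {τ : G → N →ₗ[R] N}
    {P : Type*} [AddCommGroup P] [Module R P] {υ : G → P →ₗ[R] P}
    (h : IsRepIso σ τ) (h' : IsRepIso τ υ) : IsRepIso σ υ := by
  obtain ⟨e, he⟩ := h
  obtain ⟨e', he'⟩ := h'
  exact ⟨e.trans e', fun g x => by simp [he, he']⟩

/-- The first isomorphism theorem for a subquotient with its induced action. -/
lemma isRepIso_subQuotMap_of_surjective {N : Type*} [AddCommGroup N] [Module R N]
    {τ : G → N →ₗ[R] N} {S X : Submodule R M} (hS : ActStable σ S) (hX : ActStable σ X)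
    (f : X →ₗ[R] N) (hsurj : Function.Surjective f) (hker : ∀ x : X, f x = 0 ↔ (x : M) ∈ S)
    (hequiv : ∀ (g : G) (x : X), f ⟨σ g x, hX g x x.2⟩ = τ g (f x)) :
    IsRepIso (subQuotMap σ S X) τ := by
  have hk : S.comap X.subtype = LinearMap.ker f := by
    ext x
    simp [hker x]
  refine ⟨(Submodule.quotEquivOfEq _ _ hk).trans (f.quotKerEquivOfSurjective hsurj),
    fun g x => ?_⟩
  obtain ⟨x, rfl⟩ := Submodule.mkQ_surjective _ x
  rw [subQuotMap_mkQ hS hX]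
  exact hequiv g x

/-- The second isomorphism theorem for subquotients with their induced actions. -/
lemma isRepIso_subQuotMap_of_inf_sup {S T U Y : Submodule R M} (hS : ActStable σ S)
    (hT : ActStable σ T) (hU : ActStable σ U) (hY : ActStable σ Y)
    (hinf : Y ⊓ U = S) (hsup : Y ⊔ U = T) :
    IsRepIso (subQuotMap σ S Y) (subQuotMap σ U T) := by
  have hYT : Y ≤ T := hsup ▸ le_sup_left
  refine isRepIso_subQuotMap_of_surjective hS hY
    ((U.comap T.subtype).mkQ.comp (Submodule.inclusion hYT)) ?_ ?_ ?_
  · intro z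
    obtain ⟨⟨z, hz⟩, rfl⟩ := Submodule.mkQ_surjective _ z
    obtain ⟨y, hy, u, hu, rfl⟩ := Submodule.mem_sup.1 (hsup.symm ▸ hz : z ∈ Y ⊔ U)
    refine ⟨⟨y, hy⟩, ?_⟩
    rw [LinearMap.comp_apply, ← sub_eq_zero, ← map_sub, ← LinearMap.mem_ker, Submodule.ker_mkQ]
    change y - (y + u) ∈ U
    simpa using hu
  · intro x
    rw [LinearMap.comp_apply, ← LinearMap.mem_ker, Submodule.ker_mkQ, ← hinf]
    change (x : M) ∈ U ↔ _
    simp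
  · intro g x
    rw [LinearMap.comp_apply, LinearMap.comp_apply, subQuotMap_mkQ hU hT]
    rfl

lemma isRepIso_subQuotMap_bot {X : Submodule R M} (hX : ActStable σ X) :
    IsRepIso (subQuotMap σ ⊥ X) (subAct σ X) :=
  isRepIso_subQuotMap_of_surjective actStable_bot hX LinearMap.id Function.surjective_id
    (fun x => by simp) (fun g x => Subtype.ext (subAct_coe hX g x).symm)

lemma actStable_comap_mkQ_iff {S : Submodule R M} (hS : ActStable σ S)
    {Z : Submodule R (M ⧸ S)} :
    ActStable σ (Z.comap S.mkQ) ↔ ActStable (quotMap σ S) Z := by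
  constructor
  · intro h g z hz
    obtain ⟨z, rfl⟩ := S.mkQ_surjective z
    rw [quotMap_mkQ hS]
    exact h g z hz
  · intro h g z hz
    have := h g _ hz
    rwa [quotMap_mkQ hS] at this

lemma comap_map_mkQ_of_le {S Y : Submodule R M} (h : S ≤ Y) :
    (Y.map S.mkQ).comap S.mkQ = Y := by
  rw [Submodule.comap_map_mkQ, sup_eq_right.2 h]

lemma le_comap_mkQ (S : Submodule R M) (Z : Submodule R (M ⧸ S)) : S ≤ Z.comap S.mkQ := by
  intro x hx
  have : S.mkQ x = 0 := by simpa using hx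
  rw [Submodule.mem_comap, this]
  exact Z.zero_mem

lemma comap_mkQ_injective (S : Submodule R M) :
    Function.Injective (Submodule.comap S.mkQ) :=
  Submodule.comap_injective_of_surjective S.mkQ_surjective

lemma comap_mkQ_bot (S : Submodule R M) : (⊥ : Submodule R (M ⧸ S)).comap S.mkQ = S :=
  S.ker_mkQ

lemma isSimpleSubmodule_quotMap_iff {S : Submodule R M} (hS : ActStable σ S)
    {Z : Submodule R (M ⧸ S)} :
    IsSimpleSubmodule (quotMap σ S) Z ↔ IsIrredSubquot σ S (Z.comap S.mkQ) := by
  constructor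
  · rintro ⟨h1, h2, h3⟩
    refine ⟨hS, (actStable_comap_mkQ_iff hS).2 h1, (le_comap_mkQ S Z).lt_of_ne ?_, ?_⟩
    · intro h
      refine h2 (comap_mkQ_injective S ?_)
      rw [← h, comap_mkQ_bot]
    · intro W hW hSW hWZ
      rw [← comap_map_mkQ_of_le hSW] at hW
      rcases h3 _ ((actStable_comap_mkQ_iff hS).1 hW) (Submodule.map_le_iff_le_comap.2 hWZ)
        with h | h
      · left
        rw [← comap_map_mkQ_of_le hSW, h, comap_mkQ_bot]
      · right
        rw [← h, comap_map_mkQ_of_le hSW]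
  · rintro ⟨-, h1, h2, h3⟩
    refine ⟨(actStable_comap_mkQ_iff hS).1 h1, ?_, ?_⟩
    · rintro rfl
      exact h2.ne (comap_mkQ_bot S).symm
    · intro U hU hUZ
      rcases h3 _ ((actStable_comap_mkQ_iff hS).2 hU) (le_comap_mkQ S U)
        (Submodule.comap_mono hUZ) with h | h
      · left
        apply comap_mkQ_injective S
        rw [h, comap_mkQ_bot]
      · right
        exact comap_mkQ_injective S h

lemma actStable_actSocle (σ : G → M →ₗ[R] M) : ActStable σ (actSocle σ) :=
  ActStable.sSup fun _ hW => hW.1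

lemma actStable_socFilt (σ : G → M →ₗ[R] M) (k : ℕ) : ActStable σ (socFilt σ k) := by
  induction k with
  | zero => exact actStable_bot
  | succ k ih => exact (actStable_comap_mkQ_iff ih).2 (actStable_actSocle _)

lemma socFilt_le_succ (σ : G → M →ₗ[R] M) (k : ℕ) : socFilt σ k ≤ socFilt σ (k + 1) :=
  le_comap_mkQ _ _

lemma IsIrredSubquot.le_socFilt_succ {k : ℕ} {Y : Submodule R M}
    (hY : IsIrredSubquot σ (socFilt σ k) Y) : Y ≤ socFilt σ (k + 1) := by
  have h := comap_map_mkQ_of_le hY.2.2.1.le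
  rw [← h] at hY ⊢
  exact Submodule.comap_mono
    (le_sSup ((isSimpleSubmodule_quotMap_iff (actStable_socFilt σ k)).2 hY))

lemma socFilt_succ_le {k : ℕ} {P : Submodule R M} (hP : socFilt σ k ≤ P)
    (h : ∀ Y, IsIrredSubquot σ (socFilt σ k) Y → Y ≤ P) : socFilt σ (k + 1) ≤ P := by
  rw [← comap_map_mkQ_of_le hP]
  refine Submodule.comap_mono (sSup_le fun Z hZ => ?_)
  have := h _ ((isSimpleSubmodule_quotMap_iff (actStable_socFilt σ k)).1 hZ)
  rw [← Submodule.map_comap_eq_of_surjective (Submodule.mkQ_surjective _) Z]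
  exact Submodule.map_mono this

lemma exists_isIrredSubquot_inf_eq {k : ℕ} {P : Submodule R M} (hPs : ActStable σ P)
    (hP : socFilt σ k ≤ P) (h : ¬ socFilt σ (k + 1) ≤ P) :
    ∃ Y, IsIrredSubquot σ (socFilt σ k) Y ∧ ¬ Y ≤ P ∧ Y ⊓ P = socFilt σ k := by
  by_contra! hcon
  refine h (socFilt_succ_le hP fun Y hY => ?_)
  by_contra hYP
  refine hcon Y hY hYP ((hY.2.2.2 _ (hY.2.1.inf hPs) (le_inf hY.2.2.1.le hP)
    inf_le_left).resolve_right fun h => hYP (inf_eq_left.1 h))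

/-- Layers of the socle filtration are semisimple: stable submodules between a stable `U` and
`socFilt σ (k + 1)` have complements relative to `U`. -/
lemma exists_relative_complement [IsNoetherian R M] {k : ℕ} {U P : Submodule R M}
    (hU : ActStable σ U) (hP : ActStable σ P) (hSU : socFilt σ k ≤ U) (hUP : U ≤ P)
    (hPT : P ≤ socFilt σ (k + 1)) :
    ∃ Q, ActStable σ Q ∧ U ≤ Q ∧ Q ≤ socFilt σ (k + 1) ∧ P ⊓ Q = U ∧
      P ⊔ Q = socFilt σ (k + 1) := by
  obtain ⟨Q, ⟨hQ, hUQ, hQT, hPQ⟩, hmax⟩ := WellFounded.has_min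
    (wellFounded_gt : WellFounded ((· > ·) : Submodule R M → Submodule R M → Prop))
    {Q | ActStable σ Q ∧ U ≤ Q ∧ Q ≤ socFilt σ (k + 1) ∧ P ⊓ Q = U}
    ⟨U, hU, le_rfl, hUP.trans hPT, inf_eq_right.2 hUP⟩
  refine ⟨Q, hQ, hUQ, hQT, hPQ, le_antisymm (sup_le hPT hQT) ?_⟩
  by_contra hT
  obtain ⟨Y, hY, hYn, hYi⟩ := exists_isIrredSubquot_inf_eq (hP.sup hQ)
    (hSU.trans (hUP.trans le_sup_left)) hT
  refine hmax (Q ⊔ Y) ⟨hQ.sup hY.2.1, hUQ.trans le_sup_left, sup_le hQT hY.le_socFilt_succ,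
    le_antisymm ?_ (le_inf hUP (hUQ.trans le_sup_left))⟩
    (left_lt_sup.2 fun h => hYn (h.trans le_sup_right))
  rintro x ⟨hxP, hxQ⟩
  obtain ⟨q, hq, y, hy, rfl⟩ := Submodule.mem_sup.1 hxQ
  have hyS : y ∈ socFilt σ k := by
    rw [← hYi]
    refine ⟨hy, ?_⟩
    have : y = (q + y) + -q := by abel
    rw [this]
    exact Submodule.add_mem_sup hxP (Q.neg_mem hq)
  rw [← hPQ]
  exact ⟨hxP, Q.add_mem hq (hUQ (hSU hyS))⟩

/-- `T` has a stable complement in `X` relative to `U`. -/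
def HasStableComplement (σ : G → M →ₗ[R] M) (U T X : Submodule R M) : Prop :=
  ∃ C : Submodule R M, ActStable σ C ∧ U ≤ C ∧ C ≤ X ∧ C ⊓ T = U ∧ C ⊔ T = X

lemma HasStableComplement.inf {U T X P Q : Submodule R M} (hPQ : P ⊓ Q = U) (hsup : P ⊔ Q = T)
    (hP : HasStableComplement σ P T X) (hQ : HasStableComplement σ Q T X) :
    HasStableComplement σ U T X := by
  obtain ⟨C, hC, hPC, hCX, hCT, hCX'⟩ := hP
  obtain ⟨D, hD, hQD, hDX, hDT, hDX'⟩ := hQ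
  refine ⟨C ⊓ D, hC.inf hD, hPQ ▸ inf_le_inf hPC hQD, inf_le_left.trans hCX, ?_, ?_⟩
  · rw [inf_inf_distrib_right, hCT, hDT, hPQ]
  · refine le_antisymm (sup_le (inf_le_left.trans hCX) (hCX' ▸ le_sup_right)) fun x hx => ?_
    rw [← hCX'] at hx
    obtain ⟨c, hc, t, ht, rfl⟩ := Submodule.mem_sup.1 hx
    have hcD : c ∈ D ⊔ T := hDX'.symm ▸ hCX hc
    obtain ⟨d, hd, s, hs, rfl⟩ := Submodule.mem_sup.1 hcD
    obtain ⟨p, hp, q, hq, rfl⟩ := Submodule.mem_sup.1 (hsup.symm ▸ hs : s ∈ P ⊔ Q)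
    have hmem : d + q ∈ C ⊓ D := by
      refine ⟨?_, D.add_mem hd (hQD hq)⟩
      have : d + q = (d + (p + q)) - p := by abel
      rw [this]
      exact C.sub_mem hc (hPC hp)
    have hpT : p ∈ T := hsup ▸ (le_sup_left : P ≤ P ⊔ Q) hp
    have : d + (p + q) + t = (d + q) + (p + t) := by abel
    rw [this]
    exact Submodule.add_mem_sup hmem (T.add_mem hpT ht)

lemma not_hasStableComplement_socFilt {k : ℕ} {X : Submodule R M}
    (hX : IsIrredSubquot σ (socFilt σ (k + 1)) X) :
    ¬ HasStableComplement σ (socFilt σ k) (socFilt σ (k + 1)) X := by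
  rintro ⟨C, hC, hSC, hCX, hCT, hCX'⟩
  set T := socFilt σ (k + 1) with hT
  have hirr : IsIrredSubquot σ (socFilt σ k) C := by
    refine ⟨actStable_socFilt σ k, hC, hSC.lt_of_ne ?_, fun W hW hSW hWC => ?_⟩
    · rintro rfl
      rw [sup_eq_right.2 (socFilt_le_succ σ k)] at hCX'
      exact hX.2.2.1.ne hCX'
    · have hmod : (W ⊔ T) ⊓ C = W := by
        rw [sup_inf_assoc_of_le T hWC, inf_comm T C, hCT, sup_eq_left.2 hSW]
      rcases hX.2.2.2 (W ⊔ T) (hW.sup hX.1) le_sup_right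
        (sup_le (hWC.trans hCX) hX.2.2.1.le) with h | h
      · left
        rw [← hmod, h, inf_comm, hCT]
      · right
        rw [← hmod, h, inf_eq_right.2 hCX]
  have hCT' : C ≤ T := hirr.le_socFilt_succ
  rw [sup_eq_right.2 hCT'] at hCX'
  exact hX.2.2.1.ne hCX'

/-- A simple piece on top of the layer `k + 1` of the socle filtration is a non-split extension
by a simple piece of the layer `k`. -/
lemma exists_nonsplit_socFilt [IsNoetherian R M] {k : ℕ} {X : Submodule R M}
    (hX : IsIrredSubquot σ (socFilt σ (k + 1)) X) :
    ∃ Y U, IsIrredSubquot σ (socFilt σ k) Y ∧ ActStable σ U ∧ U ≤ socFilt σ (k + 1) ∧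
      IsRepIso (subQuotMap σ U (socFilt σ (k + 1))) (subQuotMap σ (socFilt σ k) Y) ∧
      ¬ HasStableComplement σ U (socFilt σ (k + 1)) X := by
  obtain ⟨U, ⟨hU, hSU, hUT, hn⟩, hmax⟩ := WellFounded.has_min
    (wellFounded_gt : WellFounded ((· > ·) : Submodule R M → Submodule R M → Prop))
    {U | ActStable σ U ∧ socFilt σ k ≤ U ∧ U ≤ socFilt σ (k + 1) ∧
      ¬ HasStableComplement σ U (socFilt σ (k + 1)) X}
    ⟨_, actStable_socFilt σ k, le_rfl, socFilt_le_succ σ k, not_hasStableComplement_socFilt hX⟩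
  have hsplit : ∀ P, ActStable σ P → U < P → P ≤ socFilt σ (k + 1) →
      HasStableComplement σ P (socFilt σ (k + 1)) X := by
    intro P hP hUP hPT
    by_contra h
    exact hmax P ⟨hP, hSU.trans hUP.le, hPT, h⟩ hUP
  have hTU : ¬ socFilt σ (k + 1) ≤ U := by
    intro h
    have hUeq := le_antisymm hUT h
    exact hn ⟨X, hX.2.1, hUT.trans hX.2.2.1.le, le_rfl,
      (inf_eq_right.2 hX.2.2.1.le).trans hUeq.symm, sup_eq_left.2 hX.2.2.1.le⟩
  obtain ⟨Y, hY, hYU, hYi⟩ := exists_isIrredSubquot_inf_eq hU hSU hTU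
  have hP := hY.2.1.sup hU
  have hUP : U < Y ⊔ U := right_lt_sup.2 hYU
  have hPT : Y ⊔ U ≤ socFilt σ (k + 1) := sup_le hY.le_socFilt_succ hUT
  obtain ⟨Q, hQ, hUQ, hQT, hPQ, hPQ'⟩ := exists_relative_complement hU hP hSU hUP.le hPT
  have hQU : Q = U := by
    by_contra h
    exact hn (HasStableComplement.inf hPQ hPQ' (hsplit _ hP hUP hPT)
      (hsplit Q hQ (hUQ.lt_of_ne' h) hQT))
  have hsup : Y ⊔ U = socFilt σ (k + 1) := by
    rw [← hPQ', hQU, sup_assoc, sup_idem]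
  exact ⟨Y, U, hY, hU, hUT, (isRepIso_subQuotMap_of_inf_sup hY.1 (actStable_socFilt σ _) hU
    hY.2.1 hYi hsup).symm, hn⟩

/-- Iterating `exists_nonsplit_socFilt` down the socle filtration. -/
lemma exists_nonsplit_chain [IsNoetherian R M] (n : ℕ) {X : Submodule R M}
    (hX : IsIrredSubquot σ (socFilt σ n) X) :
    ∃ f : ℕ → Submodule R M, f n = X ∧ (∀ k ≤ n, IsIrredSubquot σ (socFilt σ k) (f k)) ∧
      ∀ k < n, ∃ U, ActStable σ U ∧ U ≤ socFilt σ (k + 1) ∧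
        IsRepIso (subQuotMap σ U (socFilt σ (k + 1))) (subQuotMap σ (socFilt σ k) (f k)) ∧
        ¬ HasStableComplement σ U (socFilt σ (k + 1)) (f (k + 1)) := by
  induction n generalizing X with
  | zero =>
    refine ⟨fun _ => X, rfl, fun k hk => ?_, fun k hk => absurd hk (Nat.not_lt_zero k)⟩
    rwa [Nat.le_zero.1 hk]
  | succ n ih =>
    obtain ⟨Y, U, hY, hU, hUT, hiso, hn⟩ := exists_nonsplit_socFilt hX
    obtain ⟨f, rfl, hf, hext⟩ := ih hY
    refine ⟨Function.update f (n + 1) X, by simp, fun k hk => ?_, fun k hk => ?_⟩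
    · rcases hk.lt_or_eq with h | rfl
      · rw [Function.update_of_ne h.ne]
        exact hf k (Nat.lt_succ_iff.1 h)
      · simpa using hX
    · rw [Function.update_of_ne hk.ne]
      rcases (Nat.lt_succ_iff.1 hk).lt_or_eq with h | rfl
      · rw [Function.update_of_ne (by omega)]
        exact hext k h
      · rw [Function.update_self]
        exact ⟨U, hU, hUT, hiso, hn⟩

/-- A simple submodule of a subquotient `T / S` is an irreducible subquotient `X / S`. -/
lemma exists_isIrredSubquot_of_isSimpleSubmodule {S T : Submodule R M} (hS : ActStable σ S)
    (hT : ActStable σ T) (hST : S ≤ T) {Z : Submodule R (SubQuot S T)}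
    (hZ : IsSimpleSubmodule (subQuotMap σ S T) Z) :
    ∃ X, IsIrredSubquot σ S X ∧ IsRepIso (subQuotMap σ S X) (subAct (subQuotMap σ S T) Z) := by
  obtain ⟨hZs, hZ0, hZm⟩ := hZ
  set q := (S.comap T.subtype).mkQ with hq
  have hqs : Function.Surjective q := Submodule.mkQ_surjective _
  have hq0 : ∀ t : T, q t = 0 ↔ (t : M) ∈ S := by
    intro t
    rw [← LinearMap.mem_ker, hq, Submodule.ker_mkQ]
    rfl
  set X := (Z.comap q).map T.subtype with hXdef
  have hXT : X ≤ T := Submodule.map_subtype_le _ _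
  have hmem : ∀ t : T, (t : M) ∈ X ↔ q t ∈ Z := by
    intro t
    rw [hXdef, Submodule.mem_map]
    constructor
    · rintro ⟨s, hs, hst⟩
      rwa [← Subtype.ext hst]
    · exact fun h => ⟨t, h, rfl⟩
  have hXs : ActStable σ X := by
    intro g x hx
    have h := hZs g _ ((hmem ⟨x, hXT hx⟩).1 hx)
    rw [subQuotMap_mkQ hS hT] at h
    exact (hmem _).2 h
  have hSX : S ≤ X := by
    intro x hx
    refine (hmem ⟨x, hST hx⟩).2 ?_
    rw [(hq0 _).2 hx]
    exact Z.zero_mem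
  refine ⟨X, ⟨hS, hXs, hSX.lt_of_ne ?_, ?_⟩, ?_⟩
  · intro h
    refine hZ0 (eq_bot_iff.2 fun z hz => ?_)
    obtain ⟨t, rfl⟩ := hqs z
    rw [← hmem, ← h] at hz
    exact (hq0 t).2 hz
  · intro W hW hSW hWX
    have hWm : ∀ t : T, q t ∈ (W.comap T.subtype).map q ↔ (t : M) ∈ W := by
      intro t
      constructor
      · rintro ⟨s, hs, hst⟩
        have h0 : (t - s : M) ∈ S := (hq0 (t - s)).1 (by rw [map_sub, hst, sub_self])
        simpa using W.add_mem (hSW h0) hs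
      · exact fun h => ⟨t, h, rfl⟩
    have hst : ActStable (subQuotMap σ S T) ((W.comap T.subtype).map q) := by
      rintro g _ ⟨t, ht, rfl⟩
      rw [subQuotMap_mkQ hS hT]
      exact ⟨_, hW g _ ht, rfl⟩
    have hle : (W.comap T.subtype).map q ≤ Z := by
      rintro _ ⟨t, ht, rfl⟩
      exact (hmem t).1 (hWX ht)
    rcases hZm _ hst hle with h | h
    · left
      refine le_antisymm (fun x hx => ?_) hSW
      have := (hWm ⟨x, hXT (hWX hx)⟩).2 hx
      rw [h] at this
      exact (hq0 _).1 this
    · right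
      refine le_antisymm hWX fun x hx => ?_
      have := (hmem ⟨x, hXT hx⟩).1 hx
      rw [← h] at this
      exact (hWm _).1 this
  · refine isRepIso_subQuotMap_of_surjective hS hXs
      (LinearMap.codRestrict Z (q.comp (Submodule.inclusion hXT))
        fun x => (hmem (Submodule.inclusion hXT x)).1 x.2) ?_ ?_ ?_
    · rintro ⟨z, hz⟩
      obtain ⟨t, rfl⟩ := hqs z
      exact ⟨⟨t, (hmem t).2 hz⟩, rfl⟩
    · intro x
      exact Subtype.ext_iff.trans (hq0 (Submodule.inclusion hXT x))
    · intro g x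
      apply Subtype.ext
      rw [subAct_coe hZs]
      exact (subQuotMap_mkQ hS hT g (Submodule.inclusion hXT x)).symm

/-- If some vector lies in every nonzero stable submodule, then a simple submodule is the socle. -/
lemma actSocle_eq_of_forall_mem {w : M} (hw0 : w ≠ 0)
    (hw : ∀ N : Submodule R M, ActStable σ N → N ≠ ⊥ → w ∈ N)
    {X : Submodule R M} (hX : IsIrredSubquot σ ⊥ X) : actSocle σ = X := by
  have hX0 : X ≠ ⊥ := hX.2.2.1.ne'
  have hXsimple : IsSimpleSubmodule σ X :=
    ⟨hX.2.1, hX0, fun U hU hUX => hX.2.2.2 U hU bot_le hUX⟩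
  refine le_antisymm (sSup_le fun Y hY => ?_) (le_sSup hXsimple)
  rcases hY.2.2 (Y ⊓ X) (hY.1.inf hX.2.1) inf_le_left with h | h
  · have : w ∈ Y ⊓ X := ⟨hw Y hY.1 hY.2.1, hw X hX.2.1 hX0⟩
    rw [h] at this
    exact absurd ((Submodule.mem_bot R).1 this) hw0
  · exact inf_eq_left.1 h

end ActionModules

section MaximalLattices

variable {O : Type*} [CommRing O] {K : Type*} [Field K] [Algebra O K]
variable {G : Type*} [Group G]
variable {V : Type*} [AddCommGroup V] [Module K V] [Module O V] [IsScalarTower O K V]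

lemma IsInvariantSub.actStable {ρ : Representation K G V} {Λ : Submodule O V}
    (h : IsInvariantSub ρ Λ) : ActStable (resAct ρ) Λ := by
  intro g x hx
  have := Submodule.mem_map_of_mem (f := resAct (O := O) ρ g) hx
  rwa [h g] at this

lemma isInvariantSub_of_actStable {ρ : Representation K G V} {Λ : Submodule O V}
    (h : ActStable (resAct ρ) Λ) : IsInvariantSub ρ Λ := by
  intro g
  apply le_antisymm
  · rintro _ ⟨x, hx, rfl⟩
    exact h g x hx
  · intro x hx
    refine ⟨ρ g⁻¹ x, h g⁻¹ x hx, ?_⟩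
    change ρ g (ρ g⁻¹ x) = x
    simp

lemma actStable_piSmul {ρ : Representation K G V} {π : O} {Λ : Submodule O V}
    (h : ActStable (resAct ρ) Λ) : ActStable (resAct ρ) (piSmul π Λ) := by
  rintro g _ ⟨x, hx, rfl⟩
  exact ⟨_, h g x hx, ((resAct ρ g).map_smul π x).symm⟩

/-- Every nonzero submodule of the reduction of a lattice maximal at `v` contains the class
of `v`. -/
lemma IsMaximalAt.mkQ_mem [IsDomain O] [IsDiscreteValuationRing O] [IsFractionRing O K] {π : O}
    (hπ : Irreducible π) {ρ : Representation K G V} {Λ : Submodule O V} {v : V} (h : IsMaximalAt ρ π Λ v)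
    (N : Submodule O (SubQuot (piSmul π Λ) Λ)) (hN : ActStable (redAct ρ π Λ) N) (hN0 : N ≠ ⊥) :
    ((piSmul π Λ).comap Λ.subtype).mkQ ⟨v, h.2.2.1.1⟩ ∈ N := by
  obtain ⟨⟨hfg, hspan⟩, hinv, ⟨hv, hvn⟩, hmax⟩ := h
  have hst := hinv.actStable
  set q := ((piSmul π Λ).comap Λ.subtype).mkQ with hq
  by_contra hvN
  have hne : algebraMap O K π ≠ 0 := by
    simpa using hπ.ne_zero
  have hinj : Function.Injective (LinearMap.lsmul O V π) := by
    intro x y hxy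
    refine smul_right_injective V hne ?_
    simpa [algebraMap_smul] using hxy
  set P : Submodule O V := (N.comap q).map Λ.subtype with hP
  have hmemP : ∀ t : Λ, (t : V) ∈ P ↔ q t ∈ N := by
    intro t
    rw [hP, Submodule.mem_map]
    constructor
    · rintro ⟨s, hs, hst⟩
      rwa [← Subtype.ext hst]
    · exact fun h => ⟨t, h, rfl⟩
  have hPΛ : P ≤ Λ := Submodule.map_subtype_le _ _
  set L : Submodule O V := P.comap (LinearMap.lsmul O V π) with hL
  have hq0 : ∀ t : Λ, q t = 0 ↔ (t : V) ∈ piSmul π Λ := by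
    intro t
    rw [← LinearMap.mem_ker, hq, Submodule.ker_mkQ]
    rfl
  have hΛL : Λ ≤ L := by
    intro x hx
    refine (hmemP ⟨π • x, Λ.smul_mem π hx⟩).2 ?_
    rw [(hq0 _).2 ⟨x, hx, rfl⟩]
    exact N.zero_mem
  have hLfg : L.FG := by
    have : IsNoetherian O Λ := isNoetherian_of_fg_of_noetherian Λ hfg
    refine Submodule.fg_of_fg_map_injective _ hinj ?_
    exact isNoetherian_submodule.1 this _ ((Submodule.map_comap_le _ _).trans hPΛ)
  have hLs : ActStable (resAct ρ) L := by
    intro g x hx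
    have h1 := hN g _ ((hmemP ⟨_, hPΛ hx⟩).1 hx)
    rw [redAct, subQuotMap_mkQ (actStable_piSmul hst) hst] at h1
    have h2 := (hmemP _).2 h1
    change π • resAct ρ g x ∈ P
    rw [← map_smul]
    exact h2
  have hvL : v ∉ piSmul π L := by
    rintro ⟨y, hy, hyv⟩
    have hy' : LinearMap.lsmul O V π y ∈ P := hy
    rw [hyv] at hy'
    exact hvN ((hmemP ⟨v, hv⟩).1 hy')
  have hLspan : Submodule.span K (L : Set V) = ⊤ :=
    top_unique (hspan ▸ Submodule.span_mono hΛL)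
  have hLΛ := hmax L ⟨hLfg, hLspan⟩ (isInvariantSub_of_actStable hLs) ⟨hΛL hv, hvL⟩ hΛL
  refine hN0 (eq_bot_iff.2 fun z hz => ?_)
  obtain ⟨t, rfl⟩ := Submodule.mkQ_surjective _ z
  have htP := (hmemP t).2 hz
  refine (hq0 t).2 ?_
  have hy : LinearMap.lsmul O V π ((algebraMap O K π)⁻¹ • (t : V)) = t := by
    rw [LinearMap.lsmul_apply, ← algebraMap_smul K π, smul_inv_smul₀ hne]
  refine ⟨_, ?_, hy⟩
  refine hLΛ.le ?_
  change LinearMap.lsmul O V π _ ∈ P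
  rwa [hy]

end MaximalLattices

section Statement

variable {O : Type*} [CommRing O] [IsDomain O] [IsDiscreteValuationRing O]
variable {K : Type*} [Field K] [Algebra O K] [IsFractionRing O K]
variable {G : Type*} [Group G]
variable {V : Type*} [AddCommGroup V] [Module K V] [Module O V] [IsScalarTower O K V]
variable [FiniteDimensional K V]

theorem statement_13 (π : O) (hπ : Irreducible π) (ρ : Representation K G V)
    (hirr : IsIrreducibleRep ρ) (Λ : Submodule O V) (hmax : IsMaximalLattice ρ π Λ)
    (m : ℕ) (hm : 1 ≤ m)
    {W' : Type*} [AddCommGroup W'] [Module O W'] (σ' : Representation O G W')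
    (htor : ∀ x : W', π • x = 0) (hsimple : IsSimpleAct (ofRep σ'))
    (hW' : ∃ X : Submodule O (SubQuot (socFilt (redAct ρ π Λ) (m - 1))
        (socFilt (redAct ρ π Λ) m)),
      IsSimpleSubmodule (subQuotMap (redAct ρ π Λ) (socFilt (redAct ρ π Λ) (m - 1))
        (socFilt (redAct ρ π Λ) m)) X ∧
      IsRepIso (subAct (subQuotMap (redAct ρ π Λ) (socFilt (redAct ρ π Λ) (m - 1))
        (socFilt (redAct ρ π Λ) m)) X) (ofRep σ')) :
    ∃ A B : Fin m → Submodule O (SubQuot (piSmul π Λ) Λ),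
      (∀ k, IsIrredSubquot (redAct ρ π Λ) (A k) (B k)) ∧
      IsRepIso (subQuotMap (redAct ρ π Λ) (A ⟨0, hm⟩) (B ⟨0, hm⟩))
        (subAct (redAct ρ π Λ) (actSocle (redAct ρ π Λ))) ∧
      IsRepIso (subQuotMap (redAct ρ π Λ) (A ⟨m - 1, by omega⟩) (B ⟨m - 1, by omega⟩))
        (ofRep σ') ∧
      ∀ (k : ℕ) (hk : k + 1 < m),
        RealizesExt ρ π
          (subQuotMap (redAct ρ π Λ) (A ⟨k + 1, hk⟩) (B ⟨k + 1, hk⟩))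
          (subQuotMap (redAct ρ π Λ) (A ⟨k, by omega⟩) (B ⟨k, by omega⟩)) := by
  obtain ⟨v, -, hv⟩ := hmax
  have hst := hv.2.1.actStable
  have hnoeth : IsNoetherian O Λ := isNoetherian_of_fg_of_noetherian Λ hv.1.1
  obtain ⟨n, rfl⟩ : ∃ n, m = n + 1 := ⟨m - 1, by omega⟩
  obtain ⟨Z, hZ, hZiso⟩ := hW'
  obtain ⟨X, hX, hXiso⟩ := exists_isIrredSubquot_of_isSimpleSubmodule
    (actStable_socFilt (redAct ρ π Λ) n) (actStable_socFilt (redAct ρ π Λ) (n + 1))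
    (socFilt_le_succ _ n) hZ
  obtain ⟨f, rfl, hf, hext⟩ := exists_nonsplit_chain n hX
  refine ⟨fun k => socFilt (redAct ρ π Λ) k, fun k => f k,
    fun k => hf k (Nat.lt_succ_iff.1 k.2), ?_, hXiso.trans hZiso, fun k hk => ?_⟩
  · have hw0 : ((piSmul π Λ).comap Λ.subtype).mkQ ⟨v, hv.2.2.1.1⟩ ≠ 0 := by
      rw [Ne, ← LinearMap.mem_ker, Submodule.ker_mkQ]
      exact hv.2.2.1.2
    have h0 := hf 0 (Nat.zero_le n)
    rw [actSocle_eq_of_forall_mem hw0 (hv.mkQ_mem hπ) h0]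
    exact isRepIso_subQuotMap_bot h0.2.1
  · obtain ⟨U, hU, hUT, hiso, hn⟩ := hext k (by omega)
    have hk' := hf (k + 1) (by omega)
    exact ⟨Λ, hv.1, hv.2.1, U, f (k + 1), socFilt (redAct ρ π Λ) (k + 1), hU, hk'.2.1, hk'.1,
      hUT, hk'.2.2.1.le, hiso, IsRepIso.refl _, hn⟩

end Statement
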